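/- arXiv:2211.12841 — 2 statements merged into one kernel-verified Lean document; each statement's English description precedes it below -/
import Mathlib

section
/- For any integer τ ≥ 0 and any indices u, v ∈ {1,…,m}: U^τ (V e_u) = V e_v if and only if the (u,v)-entry and the (v,u)-entry of B_τ both equal 1. -/
open Matrix

lemma reflection_isHermitian {k m : Type*} [DecidableEq k] [Fintype m] (V : Matrix k m ℂ) :
    (2 • (V * Vᴴ) - 1).IsHermitian := by
  rw [IsHermitian, conjTranspose_sub, conjTranspose_one, conjTranspose_nsmul,
    conjTranspose_mul, conjTranspose_conjTranspose]

section Reflection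

variable {k m : Type*} [Fintype k] [DecidableEq k] [Fintype m] [DecidableEq m]

lemma reflection_mul_self_isometry {V : Matrix k m ℂ} (hV : Vᴴ * V = 1) :
    (2 • (V * Vᴴ) - 1) * V = V := by
  rw [Matrix.sub_mul, Matrix.smul_mul, Matrix.mul_assoc, hV, Matrix.mul_one, Matrix.one_mul,
    two_smul, add_sub_cancel_right]

lemma reflection_mul_reflection {V : Matrix k m ℂ} (hV : Vᴴ * V = 1) :
    (2 • (V * Vᴴ) - 1) * (2 • (V * Vᴴ) - 1) = 1 := by
  rw [mul_sub, mul_smul_comm, ← Matrix.mul_assoc, reflection_mul_self_isometry hV,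
    Matrix.mul_one, sub_sub_cancel]

end Reflection

open scoped ComplexOrder in
/-- Coincidence of columns of two isometries is detected by the inner product. -/
lemma mulVec_single_eq_iff_of_isometry {k m : Type*} [Fintype k] [Fintype m] [DecidableEq m]
    {X V : Matrix k m ℂ} (hX : Xᴴ * X = 1) (hV : Vᴴ * V = 1) (u v : m) :
    X *ᵥ Pi.single u 1 = V *ᵥ Pi.single v 1 ↔ (Vᴴ * X) v u = 1 := by
  have entry (Y Z : Matrix k m ℂ) (i j : m) : (Yᴴ * Z) i j = star (Y.col i) ⬝ᵥ Z.col j := rfl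
  have hXu : star (X.col u) ⬝ᵥ X.col u = 1 := by rw [← entry, hX, one_apply_eq]
  have hVv : star (V.col v) ⬝ᵥ V.col v = 1 := by rw [← entry, hV, one_apply_eq]
  rw [mulVec_single_one, mulVec_single_one, entry]
  constructor
  · intro h
    rw [h, hVv]
  · intro h
    have h' : star (X.col u) ⬝ᵥ V.col v = 1 := by rw [star_dotProduct, h, star_one]
    rw [← sub_eq_zero, ← dotProduct_star_self_eq_zero, star_sub, sub_dotProduct,
      dotProduct_sub, dotProduct_sub, hXu, hVv, h, h']
    ring

theorem stmt_2 (k m n : ℕ) (hk : 0 < k) (hm : 0 < m) (hn : 0 < n)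
    (V : Matrix (Fin k) (Fin m) ℂ) (W : Matrix (Fin k) (Fin n) ℂ)
    (hV : Vᴴ * V = 1) (hW : Wᴴ * W = 1)
    (U : Matrix (Fin k) (Fin k) ℂ)
    (hU : U = (2 • (W * Wᴴ) - 1) * (2 • (V * Vᴴ) - 1))
    (B : ℕ → Matrix (Fin m) (Fin m) ℂ)
    (hB : ∀ t : ℕ, B t = Vᴴ * U ^ t * V)
    (τ : ℕ) (u v : Fin m) :
    (U ^ τ) *ᵥ (V *ᵥ Pi.single u 1) = V *ᵥ Pi.single v 1 ↔
      B τ u v = 1 ∧ B τ v u = 1 := by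
  have hR := reflection_mul_reflection hV
  have hRV := reflection_mul_self_isometry hV
  have hRH := reflection_isHermitian V
  have hS := reflection_mul_reflection hW
  have hSH := reflection_isHermitian W
  generalize 2 • (V * Vᴴ) - 1 = R at hU hR hRV hRH
  generalize 2 • (W * Wᴴ) - 1 = S at hU hS hSH
  have hUH : Uᴴ = R * S := by rw [hU, conjTranspose_mul, hRH.eq, hSH.eq]
  have hUU : Uᴴ * U = 1 := by
    rw [hUH, hU, Matrix.mul_assoc, ← Matrix.mul_assoc S, hS, Matrix.one_mul, hR]
  have hconj : Uᴴ * R = R * U := by rw [hUH, hU, Matrix.mul_assoc]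
  have hVR : Vᴴ * R = Vᴴ := by rw [← hRH.eq, ← conjTranspose_mul, hRV]
  have hpow : (U ^ τ)ᴴ * R = R * U ^ τ := by
    rw [conjTranspose_pow]
    exact (SemiconjBy.pow_right (a := R) (x := U) (y := Uᴴ) hconj.symm τ).symm
  have hunit : (U ^ τ)ᴴ * U ^ τ = 1 :=
    mem_unitaryGroup_iff'.mp (pow_mem (mem_unitaryGroup_iff'.mpr hUU) τ)
  have hX : (U ^ τ * V)ᴴ * (U ^ τ * V) = 1 := by
    rw [conjTranspose_mul, Matrix.mul_assoc, ← Matrix.mul_assoc _ _ V, hunit, Matrix.one_mul, hV]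
  have hherm : (B τ)ᴴ = B τ := by
    calc (B τ)ᴴ = Vᴴ * ((U ^ τ)ᴴ * V) := by
          rw [hB, conjTranspose_mul, conjTranspose_mul, conjTranspose_conjTranspose]
      _ = Vᴴ * ((U ^ τ)ᴴ * R * V) := by rw [Matrix.mul_assoc _ R, hRV]
      _ = B τ := by
          rw [hpow, hB, Matrix.mul_assoc R, ← Matrix.mul_assoc Vᴴ R, hVR, Matrix.mul_assoc]
  rw [mulVec_mulVec, mulVec_single_eq_iff_of_isometry hX hV, ← Matrix.mul_assoc, ← hB]
  refine ⟨fun h => ⟨?_, h⟩, And.right⟩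
  rw [← hherm, conjTranspose_apply, h, star_one]
end

section
/- If U^τ V = V and U^τ W = W for some integer τ ≥ 1, then U^τ = I_k. -/
open Matrix

theorem conjTranspose_mul_self_reflection {k m : ℕ} {V : Matrix (Fin k) (Fin m) ℂ}
    (hV : Vᴴ * V = 1) :
    (2 • (V * Vᴴ) - 1)ᴴ * (2 • (V * Vᴴ) - 1) = 1 := by
  have hP : (V * Vᴴ) * (V * Vᴴ) = V * Vᴴ := by
    rw [Matrix.mul_assoc, ← Matrix.mul_assoc Vᴴ, hV, Matrix.one_mul]
  have hH : (2 • (V * Vᴴ) - 1)ᴴ = 2 • (V * Vᴴ) - 1 := by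
    simp only [two_nsmul, conjTranspose_sub, conjTranspose_add, conjTranspose_mul,
      conjTranspose_conjTranspose, conjTranspose_one]
  rw [hH]
  generalize V * Vᴴ = P at hP
  have h : (2 • P - 1) * (2 • P - 1) = 4 • (P * P) - 4 • P + 1 := by noncomm_ring
  rw [h, hP, sub_self, zero_add]

open scoped ComplexOrder in
/-- A unitary matrix `T` with `(T - 1) ^ 2 = 0` is the identity. -/
theorem eq_one_of_conjTranspose_mul_self_of_sub_one_mul_self {k : ℕ}
    {T : Matrix (Fin k) (Fin k) ℂ} (hT : Tᴴ * T = 1) (h : (T - 1) * (T - 1) = 0) : T = 1 := by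
  rw [← sub_eq_zero, ← conjTranspose_mul_self_eq_zero]
  have hM : (T - 1)ᴴ = -(Tᴴ * (T - 1)) := by
    rw [mul_sub, hT, conjTranspose_sub, conjTranspose_one, mul_one, neg_sub]
  rw [hM, neg_mul, mul_assoc, h, mul_zero, neg_zero]

theorem stmt_10 (k m n : ℕ) (hk : 0 < k) (hm : 0 < m) (hn : 0 < n)
    (V : Matrix (Fin k) (Fin m) ℂ) (W : Matrix (Fin k) (Fin n) ℂ)
    (hV : Vᴴ * V = 1) (hW : Wᴴ * W = 1)
    (U : Matrix (Fin k) (Fin k) ℂ)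
    (hU : U = (2 • (W * Wᴴ) - 1) * (2 • (V * Vᴴ) - 1))
    (τ : ℕ) (hτ : 1 ≤ τ)
    (hUV : U ^ τ * V = V) (hUW : U ^ τ * W = W) :
    U ^ τ = 1 := by
  have hUU : Uᴴ * U = 1 := by
    rw [hU, conjTranspose_mul, Matrix.mul_assoc, ← Matrix.mul_assoc _ (2 • (W * Wᴴ) - 1),
      conjTranspose_mul_self_reflection hW, Matrix.one_mul, conjTranspose_mul_self_reflection hV]
  have hT : (U ^ τ)ᴴ * U ^ τ = 1 := by
    have hU' : U ∈ unitaryGroup (Fin k) ℂ := mem_unitaryGroup_iff'.2 hUU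
    exact mem_unitaryGroup_iff'.1 (pow_mem hU' τ)
  have hMV : (U ^ τ - 1) * (V * Vᴴ) = 0 := by
    rw [← Matrix.mul_assoc, Matrix.sub_mul, hUV, Matrix.one_mul, sub_self, Matrix.zero_mul]
  have hMW : (U ^ τ - 1) * (W * Wᴴ) = 0 := by
    rw [← Matrix.mul_assoc, Matrix.sub_mul, hUW, Matrix.one_mul, sub_self, Matrix.zero_mul]
  have hMU : (U ^ τ - 1) * (U - 1) = 0 := by
    have hU1 : U - 1 = (W * Wᴴ) * (4 • (V * Vᴴ) - 2) - (V * Vᴴ) * 2 := by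
      rw [hU]
      noncomm_ring
    rw [hU1, mul_sub, ← mul_assoc, ← mul_assoc, hMW, hMV, zero_mul, zero_mul, sub_zero]
  refine eq_one_of_conjTranspose_mul_self_of_sub_one_mul_self hT ?_
  nth_rewrite 2 [← mul_geom_sum U τ]
  rw [← mul_assoc, hMU, zero_mul]
end
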